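/- arXiv:1906.02030 — 4 statements merged into one kernel-verified Lean document; each statement's English description precedes it below -/
import Mathlib

section
/- Suppose Assumption 1 holds, only D is mismeasured (Z'=Z and Y'=Y almost surely), the measurement error of D is non-differential with respect to the potential values (D' is independent of (Z, Y_1, Y_0, D_1, D_0) given D), all conditioning events have positive probability, P(U=u) > 0 for u=a,n,c, r_D > 0, and RD_{Y|Z} > 0. Then: (i) P(Y=1,D'=1|Z=1) ≥ P(Y=1,D'=1|Z=0); (ii) P(Y=0,D'=0|Z=0) ≥ P(Y=0,D'=0|Z=1); (iii) P(D'=1|Y=y,Z=1) ≤ RD_{YD'|Z}/RD_{Y|Z} for y=0,1; and (iv) P(D'=1|Y=y,Z=0) ≥ RD_{(1−Y)D'|(1−Z)}/RD_{Y|Z} for y=0,1. -/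
open MeasureTheory ProbabilityTheory

noncomputable def pr {Ω : Type*} [MeasurableSpace Ω] (μ : MeasureTheory.Measure Ω)
    (A : Set Ω) : ℝ := (μ A).toReal

noncomputable def cpr {Ω : Type*} [MeasurableSpace Ω] (μ : MeasureTheory.Measure Ω)
    (B A : Set Ω) : ℝ := (ProbabilityTheory.cond μ B A).toReal

def bin01 : Set ℝ := {0, 1}

theorem cpr_eq_div {Ω : Type*} [MeasurableSpace Ω] (μ : Measure Ω) {B : Set Ω}
    (hB : MeasurableSet B) (A : Set Ω) : cpr μ B A = μ.real (B ∩ A) / μ.real B := by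
  rw [cpr, cond_apply hB, ENNReal.toReal_mul, ENNReal.toReal_inv, div_eq_inv_mul]
  rfl

theorem measureReal_split_binary {Ω : Type*} [MeasurableSpace Ω] (μ : Measure Ω)
    [IsFiniteMeasure μ] {X : Ω → ℝ} (hX : Measurable X) (hX01 : ∀ ω, X ω = 0 ∨ X ω = 1)
    (S : Set Ω) : μ.real S = μ.real (S ∩ {ω | X ω = 0}) + μ.real (S ∩ {ω | X ω = 1}) := by
  have hm : MeasurableSet {ω | X ω = 0} := hX (measurableSet_singleton 0)
  rw [← measureReal_inter_add_sdiff (μ := μ) (s := S) hm]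
  congr 2
  ext ω
  rcases hX01 ω with h | h <;> simp [h]

/-- Proportionality of `E` to `S` may be checked on the two level sets of a binary variable. -/
theorem measureReal_inter_eq_mul_of_binary {Ω : Type*} [MeasurableSpace Ω] (μ : Measure Ω)
    [IsFiniteMeasure μ] {X : Ω → ℝ} (hX : Measurable X) (hX01 : ∀ ω, X ω = 0 ∨ X ω = 1)
    {S E : Set Ω} {e : ℝ}
    (h : ∀ x ∈ bin01, μ.real (S ∩ {ω | X ω = x} ∩ E) = e * μ.real (S ∩ {ω | X ω = x})) :
    μ.real (S ∩ E) = e * μ.real S := by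
  rw [measureReal_split_binary μ hX hX01 (S ∩ E), measureReal_split_binary μ hX hX01 S,
    Set.inter_right_comm, Set.inter_right_comm S E, h 0 (by simp [bin01]),
    h 1 (by simp [bin01]), mul_add]

theorem mixture_le {s f p q : ℝ} (hfs : f ≤ s) (hq : 0 ≤ q) (hpq : 0 < p + q) :
    (s * p + f * q) / (p + q) ≤ s := by
  rw [div_le_iff₀ hpq]
  nlinarith

theorem le_mixture {s f p q : ℝ} (hfs : f ≤ s) (hp : 0 ≤ p) (hpq : 0 < p + q) :
    f ≤ (s * p + f * q) / (p + q) := by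
  rw [le_div_iff₀ hpq]
  nlinarith

set_option maxHeartbeats 1000000 in
theorem stmt11 {Ω : Type*} [MeasurableSpace Ω]
    (μ : MeasureTheory.Measure Ω) [IsProbabilityMeasure μ]
    (Z D Y D' D1 D0 Y1 Y0 : Ω → ℝ)
    (h_meas_Z : Measurable Z)
    (h_meas_D : Measurable D)
    (h_meas_Y : Measurable Y)
    (h_meas_Dp : Measurable D')
    (h_meas_D1 : Measurable D1)
    (h_meas_D0 : Measurable D0)
    (h_meas_Y1 : Measurable Y1)
    (h_meas_Y0 : Measurable Y0)
    (h_bin_Z : ∀ ω, Z ω = 0 ∨ Z ω = 1)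
    (h_bin_Dp : ∀ ω, D' ω = 0 ∨ D' ω = 1)
    (h_bin_D1 : ∀ ω, D1 ω = 0 ∨ D1 ω = 1)
    (h_bin_D0 : ∀ ω, D0 ω = 0 ∨ D0 ω = 1)
    (h_bin_Y1 : ∀ ω, Y1 ω = 0 ∨ Y1 ω = 1)
    (h_bin_Y0 : ∀ ω, Y0 ω = 0 ∨ Y0 ω = 1)
    (h_consD : ∀ ω, D ω = Z ω * D1 ω + (1 - Z ω) * D0 ω)
    (h_consY : ∀ ω, Y ω = Z ω * Y1 ω + (1 - Z ω) * Y0 ω)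
    (h_indep : IndepFun Z (fun ω => (Y1 ω, Y0 ω, D1 ω, D0 ω)) μ)
    (h_mono : ∀ᵐ ω ∂μ, D0 ω ≤ D1 ω)
    (h_exclA : cpr μ {ω | D1 ω = 1 ∧ D0 ω = 1} {ω | Y1 ω = 1}
        = cpr μ {ω | D1 ω = 1 ∧ D0 ω = 1} {ω | Y0 ω = 1})
    (h_exclN : cpr μ {ω | D1 ω = 0 ∧ D0 ω = 0} {ω | Y1 ω = 1}
        = cpr μ {ω | D1 ω = 0 ∧ D0 ω = 0} {ω | Y0 ω = 1})
    (h_ndD : ∀ d ∈ bin01, ∀ d' ∈ bin01, ∀ z ∈ bin01, ∀ d1 ∈ bin01, ∀ d0 ∈ bin01, ∀ y1 ∈ bin01, ∀ y0 ∈ bin01,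
      μ ({ω | D ω = d} ∩ {ω | Z ω = z} ∩ {ω | D1 ω = d1} ∩ {ω | D0 ω = d0} ∩ {ω | Y1 ω = y1} ∩ {ω | Y0 ω = y0}) ≠ 0 →
      cpr μ ({ω | D ω = d} ∩ {ω | Z ω = z} ∩ {ω | D1 ω = d1} ∩ {ω | D0 ω = d0} ∩ {ω | Y1 ω = y1} ∩ {ω | Y0 ω = y0}) {ω | D' ω = d'}
        = cpr μ {ω | D ω = d} {ω | D' ω = d'})
    (h_posZ : ∀ z ∈ bin01, μ {ω | Z ω = z} ≠ 0)
    (h_posD : ∀ d ∈ bin01, μ {ω | D ω = d} ≠ 0)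
    (h_posYZ : ∀ y ∈ bin01, ∀ z ∈ bin01,
      μ ({ω | Y ω = y} ∩ {ω | Z ω = z}) ≠ 0)
    (h_Ua : 0 < pr μ {ω | D1 ω = 1 ∧ D0 ω = 1})
    (h_Un : 0 < pr μ {ω | D1 ω = 0 ∧ D0 ω = 0})
    (h_Uc : 0 < pr μ {ω | D1 ω = 1 ∧ D0 ω = 0})
    (SND SPD : ℝ)
    (h_SND : SND = cpr μ {ω | D ω = 1} {ω | D' ω = 1})
    (h_SPD : SPD = cpr μ {ω | D ω = 0} {ω | D' ω = 0})
    (h_rD : 0 < SND + SPD - 1)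
    (h_RDY : 0 < (cpr μ {ω | Z ω = 1} {ω | Y ω = 1} - cpr μ {ω | Z ω = 0} {ω | Y ω = 1})) :
    cpr μ {ω | Z ω = 0} ({ω | Y ω = 1} ∩ {ω | D' ω = 1})
      ≤ cpr μ {ω | Z ω = 1} ({ω | Y ω = 1} ∩ {ω | D' ω = 1})
    ∧ cpr μ {ω | Z ω = 1} ({ω | Y ω = 0} ∩ {ω | D' ω = 0})
      ≤ cpr μ {ω | Z ω = 0} ({ω | Y ω = 0} ∩ {ω | D' ω = 0})
    ∧ (∀ y ∈ bin01,
      cpr μ ({ω | Y ω = y} ∩ {ω | Z ω = 1}) {ω | D' ω = 1}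
        ≤ (cpr μ {ω | Z ω = 1} ({ω | Y ω = 1} ∩ {ω | D' ω = 1}) - cpr μ {ω | Z ω = 0} ({ω | Y ω = 1} ∩ {ω | D' ω = 1})) / (cpr μ {ω | Z ω = 1} {ω | Y ω = 1} - cpr μ {ω | Z ω = 0} {ω | Y ω = 1}))
    ∧ (∀ y ∈ bin01,
      (cpr μ {ω | Z ω = 0} ({ω | Y ω = 0} ∩ {ω | D' ω = 1}) - cpr μ {ω | Z ω = 1} ({ω | Y ω = 0} ∩ {ω | D' ω = 1})) / (cpr μ {ω | Z ω = 1} {ω | Y ω = 1} - cpr μ {ω | Z ω = 0} {ω | Y ω = 1})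
        ≤ cpr μ ({ω | Y ω = y} ∩ {ω | Z ω = 0}) {ω | D' ω = 1}) := by
  have m0 : (0 : ℝ) ∈ bin01 := by simp [bin01]
  have m1 : (1 : ℝ) ∈ bin01 := by simp [bin01]
  have ms : ∀ {X : Ω → ℝ}, Measurable X → ∀ x : ℝ, MeasurableSet {ω | X ω = x} :=
    fun hX x => hX (measurableSet_singleton x)
  have h_bin_D : ∀ ω, D ω = 0 ∨ D ω = 1 := by
    intro ω
    rw [h_consD]
    rcases h_bin_Z ω with h | h <;> simp [h, h_bin_D1 ω, h_bin_D0 ω]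
  set e : ℝ → ℝ := fun d => cpr μ {ω | D ω = d} {ω | D' ω = 1} with he
  have misclassified : ∀ d ∈ bin01, ∀ z ∈ bin01, ∀ y ∈ bin01,
      μ.real ({ω | D ω = d} ∩ {ω | Z ω = z} ∩ {ω | Y ω = y} ∩ {ω | D' ω = 1})
        = e d * μ.real ({ω | D ω = d} ∩ {ω | Z ω = z} ∩ {ω | Y ω = y}) := by
    intro d hd z hz y hy
    refine measureReal_inter_eq_mul_of_binary μ h_meas_D1 h_bin_D1 fun d1 hd1 => ?_
    refine measureReal_inter_eq_mul_of_binary μ h_meas_D0 h_bin_D0 fun d0 hd0 => ?_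
    refine measureReal_inter_eq_mul_of_binary μ h_meas_Y1 h_bin_Y1 fun y1 hy1 => ?_
    refine measureReal_inter_eq_mul_of_binary μ h_meas_Y0 h_bin_Y0 fun y0 hy0 => ?_
    set C := {ω | D ω = d} ∩ {ω | Z ω = z} ∩ {ω | D1 ω = d1} ∩ {ω | D0 ω = d0} ∩
      {ω | Y1 ω = y1} ∩ {ω | Y0 ω = y0} with hC
    have hCm : MeasurableSet C :=
      (((((ms h_meas_D d).inter (ms h_meas_Z z)).inter (ms h_meas_D1 d1)).inter
        (ms h_meas_D0 d0)).inter (ms h_meas_Y1 y1)).inter (ms h_meas_Y0 y0)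
    have hCE : μ.real (C ∩ {ω | D' ω = 1}) = e d * μ.real C := by
      by_cases h0 : μ C = 0
      · have h1 : μ (C ∩ {ω | D' ω = 1}) = 0 := measure_mono_null Set.inter_subset_left h0
        simp [Measure.real, h0, h1]
      · have h1 := h_ndD d hd 1 m1 z hz d1 hd1 d0 hd0 y1 hy1 y0 hy0 h0
        have h2 : μ.real C ≠ 0 := by
          simpa [Measure.real, ENNReal.toReal_eq_zero_iff] using h0
        rw [cpr_eq_div μ hCm, div_eq_iff h2] at h1
        exact h1
    have hset : {ω | D ω = d} ∩ {ω | Z ω = z} ∩ {ω | Y ω = y} ∩ {ω | D1 ω = d1} ∩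
        {ω | D0 ω = d0} ∩ {ω | Y1 ω = y1} ∩ {ω | Y0 ω = y0} = C ∩ {ω | Y ω = y} := by
      ext ω
      simp only [hC, Set.mem_inter_iff, Set.mem_ofPred_eq]
      tauto
    rw [hset]
    by_cases hyc : z * y1 + (1 - z) * y0 = y
    · have : C ∩ {ω | Y ω = y} = C := by
        refine Set.inter_eq_left.2 fun ω hω => ?_
        obtain ⟨⟨⟨⟨⟨-, hz⟩, -⟩, -⟩, h1⟩, h0⟩ := hω
        simp only [Set.mem_ofPred_eq] at hz h1 h0 ⊢
        rw [h_consY, hz, h1, h0, hyc]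
      rw [this, hCE]
    · have : C ∩ {ω | Y ω = y} = ∅ := by
        refine Set.eq_empty_of_forall_notMem fun ω hω => hyc ?_
        obtain ⟨⟨⟨⟨⟨⟨-, hz⟩, -⟩, -⟩, h1⟩, h0⟩, h⟩ := hω
        simp only [Set.mem_ofPred_eq] at hz h1 h0 h
        rw [← h, h_consY, hz, h1, h0]
      simp [this]
  have indep : ∀ (z : ℝ) (T : Set (ℝ × ℝ × ℝ × ℝ)), MeasurableSet T →
      μ.real ({ω | Z ω = z} ∩ {ω | (Y1 ω, Y0 ω, D1 ω, D0 ω) ∈ T})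
        = μ.real {ω | Z ω = z} * μ.real {ω | (Y1 ω, Y0 ω, D1 ω, D0 ω) ∈ T} := by
    intro z T hT
    have := h_indep.measure_inter_preimage_eq_mul {z} T (measurableSet_singleton z) hT
    have h := congrArg ENNReal.toReal this
    rw [ENNReal.toReal_mul] at h
    exact h
  set w : (Ω → ℝ) → ℝ → ℝ → ℝ → ℝ := fun V v a b =>
    μ.real ({ω | V ω = v} ∩ {ω | D1 ω = a ∧ D0 ω = b}) with hw
  have cell1 : ∀ d y : ℝ, μ.real ({ω | D ω = d} ∩ {ω | Z ω = 1} ∩ {ω | Y ω = y})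
      = μ.real {ω | Z ω = 1} * (w Y1 y d 0 + w Y1 y d 1) := by
    intro d y
    have h := indep 1 {p | p.1 = y ∧ p.2.2.1 = d}
      ((measurableSet_eq_fun (by fun_prop) (by fun_prop)).inter
        (measurableSet_eq_fun (by fun_prop) (by fun_prop)))
    have h1 : {ω | D ω = d} ∩ {ω | Z ω = 1} ∩ {ω | Y ω = y} = {ω | Z ω = 1} ∩
        {ω | (Y1 ω, Y0 ω, D1 ω, D0 ω) ∈
          ({p | p.1 = y ∧ p.2.2.1 = d} : Set (ℝ × ℝ × ℝ × ℝ))} := by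
      ext ω
      simp only [Set.mem_inter_iff, Set.mem_ofPred_eq, h_consD, h_consY]
      constructor
      · rintro ⟨⟨h1, h2⟩, h3⟩
        simp_all
      · rintro ⟨h1, h2, h3⟩
        simp_all
    rw [h1, h, measureReal_split_binary μ h_meas_D0 h_bin_D0 {ω | _ ∈ _}]
    simp only [hw, Set.mem_ofPred_eq, ← Set.ofPred_and, and_assoc]
  have cell0 : ∀ d y : ℝ, μ.real ({ω | D ω = d} ∩ {ω | Z ω = 0} ∩ {ω | Y ω = y})
      = μ.real {ω | Z ω = 0} * (w Y0 y 0 d + w Y0 y 1 d) := by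
    intro d y
    have h := indep 0 {p | p.2.1 = y ∧ p.2.2.2 = d}
      ((measurableSet_eq_fun (by fun_prop) (by fun_prop)).inter
        (measurableSet_eq_fun (by fun_prop) (by fun_prop)))
    have h1 : {ω | D ω = d} ∩ {ω | Z ω = 0} ∩ {ω | Y ω = y} = {ω | Z ω = 0} ∩
        {ω | (Y1 ω, Y0 ω, D1 ω, D0 ω) ∈
          ({p | p.2.1 = y ∧ p.2.2.2 = d} : Set (ℝ × ℝ × ℝ × ℝ))} := by
      ext ω
      simp only [Set.mem_inter_iff, Set.mem_ofPred_eq, h_consD, h_consY]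
      constructor
      · rintro ⟨⟨h1, h2⟩, h3⟩
        simp_all
      · rintro ⟨h1, h2, h3⟩
        simp_all
    rw [h1, h, measureReal_split_binary μ h_meas_D1 h_bin_D1 {ω | _ ∈ _}]
    simp only [hw, Set.mem_ofPred_eq, ← Set.ofPred_and, and_assoc]
    simp only [and_comm]
  have w_nonneg : ∀ V v a b, 0 ≤ w V v a b := fun _ _ _ _ => measureReal_nonneg
  have no_defiers : ∀ V v, w V v 0 1 = 0 := by
    intro V v
    have h : μ {ω | ¬ D0 ω ≤ D1 ω} = 0 := h_mono
    have : μ ({ω | V ω = v} ∩ {ω | D1 ω = 0 ∧ D0 ω = 1}) = 0 := by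
      refine measure_mono_null ?_ h
      rintro ω ⟨-, h1, h0⟩
      simp only [Set.mem_ofPred_eq, h1, h0]
      norm_num
    simp [hw, Measure.real, this]
  have w_total : ∀ a b, w Y1 0 a b + w Y1 1 a b = w Y0 0 a b + w Y0 1 a b := by
    intro a b
    have h1 := measureReal_split_binary μ h_meas_Y1 h_bin_Y1 {ω | D1 ω = a ∧ D0 ω = b}
    have h0 := measureReal_split_binary μ h_meas_Y0 h_bin_Y0 {ω | D1 ω = a ∧ D0 ω = b}
    simp only [hw]
    simp only [Set.inter_comm {ω | D1 ω = a ∧ D0 ω = b}] at h1 h0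
    rw [← h1, ← h0]
  have exclusion : ∀ a b : ℝ, 0 < pr μ {ω | D1 ω = a ∧ D0 ω = b} →
      cpr μ {ω | D1 ω = a ∧ D0 ω = b} {ω | Y1 ω = 1}
        = cpr μ {ω | D1 ω = a ∧ D0 ω = b} {ω | Y0 ω = 1} → w Y1 1 a b = w Y0 1 a b := by
    intro a b hpos h
    have hm : MeasurableSet {ω | D1 ω = a ∧ D0 ω = b} :=
      (ms h_meas_D1 a).inter (ms h_meas_D0 b)
    change 0 < μ.real _ at hpos
    rw [cpr_eq_div μ hm, cpr_eq_div μ hm, div_left_inj' hpos.ne'] at h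
    simpa only [hw, Set.inter_comm] using h
  have exA := exclusion 1 1 h_Ua h_exclA
  have exN := exclusion 0 0 h_Un h_exclN
  have totA := w_total 1 1
  have totN := w_total 0 0
  have totC := w_total 1 0
  have posZ : ∀ z ∈ bin01, 0 < μ.real {ω | Z ω = z} := fun z hz =>
    ENNReal.toReal_pos (h_posZ z hz) (measure_ne_top _ _)
  have outcome : ∀ z ∈ bin01, ∀ y ∈ bin01, ∀ g : ℝ → ℝ → ℝ,
      (∀ d y, μ.real ({ω | D ω = d} ∩ {ω | Z ω = z} ∩ {ω | Y ω = y})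
        = μ.real {ω | Z ω = z} * g d y) →
      cpr μ {ω | Z ω = z} {ω | Y ω = y} = g 1 y + g 0 y ∧
      cpr μ {ω | Z ω = z} ({ω | Y ω = y} ∩ {ω | D' ω = 1}) = e 1 * g 1 y + e 0 * g 0 y ∧
      cpr μ {ω | Z ω = z} ({ω | Y ω = y} ∩ {ω | D' ω = 0})
        = (1 - e 1) * g 1 y + (1 - e 0) * g 0 y ∧
      cpr μ ({ω | Y ω = y} ∩ {ω | Z ω = z}) {ω | D' ω = 1}
        = (e 1 * g 1 y + e 0 * g 0 y) / (g 1 y + g 0 y) ∧ 0 < g 1 y + g 0 y := by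
    intro z hz y hy g hg
    have hp := posZ z hz
    have hYZ : 0 < μ.real ({ω | Y ω = y} ∩ {ω | Z ω = z}) :=
      ENNReal.toReal_pos (h_posYZ y hy z hz) (measure_ne_top _ _)
    have perm : ∀ d, {ω | Y ω = y} ∩ {ω | Z ω = z} ∩ {ω | D ω = d}
        = {ω | D ω = d} ∩ {ω | Z ω = z} ∩ {ω | Y ω = y} := by
      intro d
      ext ω
      simp only [Set.mem_inter_iff, Set.mem_ofPred_eq]
      tauto
    have t1 : μ.real ({ω | Y ω = y} ∩ {ω | Z ω = z})
        = μ.real {ω | Z ω = z} * (g 1 y + g 0 y) := by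
      rw [measureReal_split_binary μ h_meas_D h_bin_D, perm, perm, hg, hg]
      ring
    have t2 : μ.real ({ω | Y ω = y} ∩ {ω | Z ω = z} ∩ {ω | D' ω = 1})
        = μ.real {ω | Z ω = z} * (e 1 * g 1 y + e 0 * g 0 y) := by
      rw [measureReal_split_binary μ h_meas_D h_bin_D, Set.inter_right_comm,
        Set.inter_right_comm _ _ {ω | D ω = 1}, perm, perm, misclassified 0 m0 z hz y hy,
        misclassified 1 m1 z hz y hy, hg, hg]
      ring
    have t3 : μ.real ({ω | Y ω = y} ∩ {ω | Z ω = z} ∩ {ω | D' ω = 0})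
        = μ.real {ω | Z ω = z} * ((1 - e 1) * g 1 y + (1 - e 0) * g 0 y) := by
      have := measureReal_split_binary μ h_meas_Dp h_bin_Dp ({ω | Y ω = y} ∩ {ω | Z ω = z})
      rw [t1, t2] at this
      linear_combination -this
    have hYZm := (ms h_meas_Y y).inter (ms h_meas_Z z)
    have hpos : 0 < g 1 y + g 0 y := by
      rw [t1] at hYZ
      exact pos_of_mul_pos_right hYZ hp.le
    refine ⟨?_, ?_, ?_, ?_, hpos⟩
    · rw [cpr_eq_div μ (ms h_meas_Z z), Set.inter_comm, t1, mul_div_cancel_left₀ _ hp.ne']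
    · rw [cpr_eq_div μ (ms h_meas_Z z), ← Set.inter_assoc, Set.inter_comm {ω | Z ω = z}, t2,
        mul_div_cancel_left₀ _ hp.ne']
    · rw [cpr_eq_div μ (ms h_meas_Z z), ← Set.inter_assoc, Set.inter_comm {ω | Z ω = z}, t3,
        mul_div_cancel_left₀ _ hp.ne']
    · rw [cpr_eq_div μ hYZm, t1, t2, mul_div_mul_left _ _ hp.ne']
  have e_nonneg : ∀ d, 0 ≤ e d := fun d => ENNReal.toReal_nonneg
  have posD : ∀ d ∈ bin01, 0 < μ.real {ω | D ω = d} := fun d hd =>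
    ENNReal.toReal_pos (h_posD d hd) (measure_ne_top _ _)
  have compl : ∀ d ∈ bin01, cpr μ {ω | D ω = d} {ω | D' ω = 0} = 1 - e d := by
    intro d hd
    have hp := posD d hd
    have := measureReal_split_binary μ h_meas_Dp h_bin_Dp {ω | D ω = d}
    simp only [he]
    rw [cpr_eq_div μ (ms h_meas_D d), cpr_eq_div μ (ms h_meas_D d)]
    field_simp
    linarith
  have e1_le : e 1 ≤ 1 := by
    have h : 0 ≤ cpr μ {ω | D ω = 1} {ω | D' ω = 0} := ENNReal.toReal_nonneg
    rw [compl 1 m1] at h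
    linarith
  have h_e : e 0 < e 1 := by
    rw [compl 0 m0] at h_SPD
    change SND = e 1 at h_SND
    linarith
  have e0_nonneg := e_nonneg 0
  obtain ⟨a11, b11, c11, d11, p11⟩ := outcome 1 m1 1 m1 _ cell1
  obtain ⟨a10, b10, c10, d10, p10⟩ := outcome 1 m1 0 m0 _ cell1
  obtain ⟨a01, b01, c01, d01, p01⟩ := outcome 0 m0 1 m1 _ cell0
  obtain ⟨a00, b00, c00, d00, p00⟩ := outcome 0 m0 0 m0 _ cell0
  have exA' : w Y1 0 1 1 = w Y0 0 1 1 := by linarith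
  have exN' : w Y1 0 0 0 = w Y0 0 0 0 := by linarith
  have bound1 : ∀ y ∈ bin01,
      cpr μ ({ω | Y ω = y} ∩ {ω | Z ω = 1}) {ω | D' ω = 1} ≤ e 1 := by
    rintro y (rfl | rfl)
    · rw [d10]
      exact mixture_le h_e.le (add_nonneg (w_nonneg ..) (w_nonneg ..)) p10
    · rw [d11]
      exact mixture_le h_e.le (add_nonneg (w_nonneg ..) (w_nonneg ..)) p11
  have bound0 : ∀ y ∈ bin01,
      e 0 ≤ cpr μ ({ω | Y ω = y} ∩ {ω | Z ω = 0}) {ω | D' ω = 1} := by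
    rintro y (rfl | rfl)
    · rw [d00]
      exact le_mixture h_e.le (add_nonneg (w_nonneg ..) (w_nonneg ..)) p00
    · rw [d01]
      exact le_mixture h_e.le (add_nonneg (w_nonneg ..) (w_nonneg ..)) p01
  have hC0 := w_nonneg Y0 1 1 0
  have hC1' := w_nonneg Y1 0 1 0
  rw [a11, a01, b11, b01, c10, c00, b10, b00]
  rw [a11, a01] at h_RDY
  simp only [no_defiers, exA, exN, exA', exN'] at h_RDY ⊢
  clear_value e w
  have hCC : 0 < w Y1 1 1 0 - w Y0 1 1 0 := by linarith
  have k1 : 0 ≤ (e 1 - e 0) * w Y0 1 1 0 := mul_nonneg (sub_nonneg.2 h_e.le) hC0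
  have k2 : 0 ≤ (e 1 - e 0) * w Y1 0 1 0 := mul_nonneg (sub_nonneg.2 h_e.le) hC1'
  have k3 : 0 ≤ e 1 * (w Y1 1 1 0 - w Y0 1 1 0) :=
    mul_nonneg (e0_nonneg.trans h_e.le) hCC.le
  have k4 : 0 ≤ (1 - e 0) * (w Y1 1 1 0 - w Y0 1 1 0) :=
    mul_nonneg (by linarith) hCC.le
  have totC' : w Y0 0 1 0 = w Y1 0 1 0 + w Y1 1 1 0 - w Y0 1 1 0 := by linarith
  rw [totC']
  refine ⟨?_, ?_, fun y hy => (bound1 y hy).trans ?_, fun y hy => le_trans ?_ (bound0 y hy)⟩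
  · linarith
  · linarith
  · rw [le_div_iff₀ (by linarith)]
    linarith
  · rw [div_le_iff₀ (by linarith)]
    linarith
end

section
/- Let Z, D', Y be binary (0/1) random variables on a probability space with all conditioning events below having positive probability and RD_{Y|Z} > 0. If the Balke–Pearl inequalities hold, namely P(Y=y,D'=1|Z=1) ≥ P(Y=y,D'=1|Z=0) for y=0,1 and P(Y=y,D'=0|Z=0) ≥ P(Y=y,D'=0|Z=1) for y=0,1, then the following also hold: P(D'=1|Y=y,Z=1) ≤ RD_{YD'|Z}/RD_{Y|Z} for y=0,1, and P(D'=1|Y=y,Z=0) ≥ RD_{(1−Y)D'|(1−Z)}/RD_{Y|Z} for y=0,1. -/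
open MeasureTheory ProbabilityTheory

lemma cpr_nonneg {Ω : Type*} [MeasurableSpace Ω] (μ : Measure Ω) (B A : Set Ω) :
    0 ≤ cpr μ B A :=
  ENNReal.toReal_nonneg

lemma cpr_le_one {Ω : Type*} [MeasurableSpace Ω] (μ : Measure Ω) [IsFiniteMeasure μ]
    {B : Set Ω} (hB : μ B ≠ 0) (A : Set Ω) : cpr μ B A ≤ 1 := by
  have := cond_isProbabilityMeasure hB
  exact measureReal_le_one (μ := ProbabilityTheory.cond μ B)

lemma cpr_eq_add_of_binary {Ω : Type*} [MeasurableSpace Ω] (μ : Measure Ω) [IsFiniteMeasure μ]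
    {B : Set Ω} (hB : μ B ≠ 0) (A : Set Ω) {D : Ω → ℝ} (hD : Measurable D)
    (hbin : ∀ ω, D ω = 0 ∨ D ω = 1) :
    cpr μ B A = cpr μ B (A ∩ {ω | D ω = 1}) + cpr μ B (A ∩ {ω | D ω = 0}) := by
  have := cond_isProbabilityMeasure hB
  have hdiff : A \ {ω | D ω = 1} = A ∩ {ω | D ω = 0} := by
    ext ω
    rcases hbin ω with h | h <;> simp [h]
  rw [← hdiff]
  exact (measureReal_inter_add_sdiff (μ := ProbabilityTheory.cond μ B) (s := A)
    (hD (measurableSet_singleton 1))).symm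

set_option maxHeartbeats 1000000 in
theorem stmt12 {Ω : Type*} [MeasurableSpace Ω]
    (μ : MeasureTheory.Measure Ω) [IsProbabilityMeasure μ]
    (Z D' Y : Ω → ℝ)
    (h_meas_Z : Measurable Z)
    (h_meas_Dp : Measurable D')
    (h_meas_Y : Measurable Y)
    (h_bin_Z : ∀ ω, Z ω = 0 ∨ Z ω = 1)
    (h_bin_Dp : ∀ ω, D' ω = 0 ∨ D' ω = 1)
    (h_bin_Y : ∀ ω, Y ω = 0 ∨ Y ω = 1)
    (h_posZ : ∀ z ∈ bin01, μ {ω | Z ω = z} ≠ 0)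
    (h_posYZ : ∀ y ∈ bin01, ∀ z ∈ bin01,
      μ ({ω | Y ω = y} ∩ {ω | Z ω = z}) ≠ 0)
    (h_RDY : 0 < (cpr μ {ω | Z ω = 1} {ω | Y ω = 1} - cpr μ {ω | Z ω = 0} {ω | Y ω = 1}))
    (h_BP1 : ∀ y ∈ bin01,
      cpr μ {ω | Z ω = 0} ({ω | Y ω = y} ∩ {ω | D' ω = 1})
        ≤ cpr μ {ω | Z ω = 1} ({ω | Y ω = y} ∩ {ω | D' ω = 1}))
    (h_BP0 : ∀ y ∈ bin01,
      cpr μ {ω | Z ω = 1} ({ω | Y ω = y} ∩ {ω | D' ω = 0})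
        ≤ cpr μ {ω | Z ω = 0} ({ω | Y ω = y} ∩ {ω | D' ω = 0})) :
    (∀ y ∈ bin01,
      cpr μ ({ω | Y ω = y} ∩ {ω | Z ω = 1}) {ω | D' ω = 1}
        ≤ (cpr μ {ω | Z ω = 1} ({ω | Y ω = 1} ∩ {ω | D' ω = 1}) - cpr μ {ω | Z ω = 0} ({ω | Y ω = 1} ∩ {ω | D' ω = 1})) / (cpr μ {ω | Z ω = 1} {ω | Y ω = 1} - cpr μ {ω | Z ω = 0} {ω | Y ω = 1}))
    ∧ (∀ y ∈ bin01,
      (cpr μ {ω | Z ω = 0} ({ω | Y ω = 0} ∩ {ω | D' ω = 1}) - cpr μ {ω | Z ω = 1} ({ω | Y ω = 0} ∩ {ω | D' ω = 1})) / (cpr μ {ω | Z ω = 1} {ω | Y ω = 1} - cpr μ {ω | Z ω = 0} {ω | Y ω = 1})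
        ≤ cpr μ ({ω | Y ω = y} ∩ {ω | Z ω = 0}) {ω | D' ω = 1}) := by
  have h0 : (0 : ℝ) ∈ bin01 := Or.inl rfl
  have h1 : (1 : ℝ) ∈ bin01 := Or.inr rfl
  constructor
  · intro y hy
    refine (cpr_le_one μ (h_posYZ y hy 1 h1) _).trans ((one_le_div h_RDY).mpr ?_)
    rw [cpr_eq_add_of_binary μ (h_posZ 1 h1) {ω | Y ω = 1} h_meas_Dp h_bin_Dp,
      cpr_eq_add_of_binary μ (h_posZ 0 h0) {ω | Y ω = 1} h_meas_Dp h_bin_Dp]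
    linarith [h_BP0 1 h1]
  · intro y _
    exact (div_nonpos_of_nonpos_of_nonneg (sub_nonpos.mpr (h_BP1 0 h0)) h_RDY.le).trans
      (cpr_nonneg _ _ _)
end

section
/- Suppose Assumption 1 holds, only D is mismeasured (Z'=Z and Y'=Y almost surely), all conditioning events have positive probability, P(U=c) > 0, and define the differential sensitivities and specificities SN_D^1 = P(D'=1|D=1,Z=1), SN_D^0 = P(D'=1|D=1,Z=0), SP_D^1 = P(D'=0|D=0,Z=1), SP_D^0 = P(D'=0|D=0,Z=0), with SN_D^1 + SP_D^1 − 1 ≠ 0 and SN_D^0 + SP_D^0 − 1 ≠ 0. If the quantity Δ := [P(D'=1|Z=1) − (1−SP_D^1)] / (SN_D^1 + SP_D^1 − 1) − [P(D'=1|Z=0) − (1−SP_D^0)] / (SN_D^0 + SP_D^0 − 1) is nonzero, then CACE = RD_{Y|Z} / Δ, where CACE = E(Y_1 − Y_0 | U=c). -/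
open MeasureTheory ProbabilityTheory

section ConditionalProbability

variable {Ω : Type*} [MeasurableSpace Ω] (μ : Measure Ω)

lemma pr_mul_cpr [IsFiniteMeasure μ] {B : Set Ω} (hB : MeasurableSet B) (A : Set Ω) :
    pr μ B * cpr μ B A = pr μ (B ∩ A) := by
  unfold pr cpr
  rw [← ENNReal.toReal_mul, mul_comm, cond_mul_eq_inter hB]

lemma pr_ne_zero [IsFiniteMeasure μ] {A : Set Ω} (h : μ A ≠ 0) : pr μ A ≠ 0 :=
  ENNReal.toReal_ne_zero.2 ⟨h, measure_ne_top μ A⟩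

lemma pr_inter_add_pr_inter_compl [IsFiniteMeasure μ] (B : Set Ω) {A : Set Ω}
    (hA : MeasurableSet A) : pr μ (B ∩ A) + pr μ (B ∩ Aᶜ) = pr μ B := by
  simpa [pr, Measure.real, Set.sdiff_eq] using measureReal_inter_add_sdiff (μ := μ) (s := B) hA

/-- The prevalence of a misclassified event is recovered from its apparent prevalence by the
sensitivity and the specificity of the classification. -/
lemma cpr_sub_one_sub_specificity_div [IsFiniteMeasure μ] {B A T : Set Ω}
    (hB : MeasurableSet B) (hA : MeasurableSet A) (hT : MeasurableSet T)
    (hAB : μ (A ∩ B) ≠ 0)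
    (hr : cpr μ (A ∩ B) T + cpr μ (Aᶜ ∩ B) Tᶜ - 1 ≠ 0) :
    (cpr μ B T - (1 - cpr μ (Aᶜ ∩ B) Tᶜ)) / (cpr μ (A ∩ B) T + cpr μ (Aᶜ ∩ B) Tᶜ - 1)
      = cpr μ B A := by
  have hb : pr μ B ≠ 0 :=
    pr_ne_zero μ fun h => hAB (measure_mono_null Set.inter_subset_right h)
  have e1 := pr_mul_cpr μ (hA.inter hB) T
  have e2 := pr_mul_cpr μ (hA.compl.inter hB) Tᶜ
  have e3 := pr_mul_cpr μ hB T
  have e4 := pr_mul_cpr μ hB A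
  have e5 := pr_inter_add_pr_inter_compl μ B hA
  have e6 := pr_inter_add_pr_inter_compl μ (B ∩ T) hA
  have e7 := pr_inter_add_pr_inter_compl μ (Aᶜ ∩ B) hT
  rw [Set.inter_right_comm B T A, Set.inter_comm B A, Set.inter_right_comm B T Aᶜ,
    Set.inter_comm B Aᶜ] at e6
  rw [Set.inter_comm B Aᶜ] at e5
  rw [Set.inter_comm B A] at e4 e5
  rw [div_eq_iff hr]
  apply mul_left_cancel₀ hb
  rw [← e4] at e1 e5
  have e8 : pr μ (Aᶜ ∩ B) = pr μ B - pr μ B * cpr μ B A := by linarith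
  rw [e8] at e2 e7
  linear_combination e3 - e1 - e6 + e7 + e2

lemma cpr_eq_pr_of_indepFun [IsFiniteMeasure μ] {Z X V : Ω → ℝ} (hZ : Measurable Z)
    (h : IndepFun Z X μ) {z : ℝ} (hz : μ {ω | Z ω = z} ≠ 0) (hV : ∀ ω, Z ω = z → V ω = X ω)
    (x : ℝ) : cpr μ {ω | Z ω = z} {ω | V ω = x} = pr μ {ω | X ω = x} := by
  have hm : MeasurableSet {ω | Z ω = z} := hZ (measurableSet_singleton z)
  have e := pr_mul_cpr μ hm {ω | V ω = x}
  have hs : {ω | Z ω = z} ∩ {ω | V ω = x} = {ω | Z ω = z} ∩ {ω | X ω = x} := by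
    ext ω
    simp only [Set.mem_inter_iff, Set.mem_ofPred_eq]
    exact and_congr_right fun hω => by rw [hV ω hω]
  have hi : pr μ ({ω | Z ω = z} ∩ {ω | X ω = x}) = pr μ {ω | Z ω = z} * pr μ {ω | X ω = x} := by
    unfold pr
    rw [← ENNReal.toReal_mul]
    exact congrArg _ (h.measure_inter_preimage_eq_mul {z} {x}
      (measurableSet_singleton z) (measurableSet_singleton x))
  rw [hs, hi] at e
  exact mul_left_cancel₀ (pr_ne_zero μ hz) e

/-- Under monotonicity every event splits along compliers, always-takers and never-takers. -/
lemma pr_eq_sum_strata [IsFiniteMeasure μ] {D1 D0 : Ω → ℝ}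
    (hD1 : Measurable D1) (hD0 : Measurable D0)
    (hb1 : ∀ ω, D1 ω = 0 ∨ D1 ω = 1) (hb0 : ∀ ω, D0 ω = 0 ∨ D0 ω = 1)
    (hmono : ∀ᵐ ω ∂μ, D0 ω ≤ D1 ω) (S : Set Ω) :
    pr μ S = pr μ ({ω | D1 ω = 1 ∧ D0 ω = 0} ∩ S) + pr μ ({ω | D1 ω = 1 ∧ D0 ω = 1} ∩ S)
      + pr μ ({ω | D1 ω = 0 ∧ D0 ω = 0} ∩ S) := by
  have h1 : MeasurableSet {ω | D1 ω = 1} := hD1 (measurableSet_singleton 1)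
  have h0 : MeasurableSet {ω | D0 ω = 0} := hD0 (measurableSet_singleton 0)
  rw [← pr_inter_add_pr_inter_compl μ S h1, ← pr_inter_add_pr_inter_compl μ (S ∩ _) h0]
  have hn : pr μ (S ∩ {ω | D1 ω = 1}ᶜ) = pr μ ({ω | D1 ω = 0 ∧ D0 ω = 0} ∩ S) := by
    refine congrArg ENNReal.toReal (measure_congr ?_)
    filter_upwards [hmono] with ω hω
    refine propext ?_
    change (ω ∈ S ∧ ¬ D1 ω = 1) ↔ ((D1 ω = 0 ∧ D0 ω = 0) ∧ ω ∈ S)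
    revert hω
    rcases hb1 ω with h | h <;> rcases hb0 ω with h' | h' <;> norm_num [h, h']
  rw [hn]
  congr 3
  · ext ω
    simp only [Set.mem_inter_iff, Set.mem_ofPred_eq]
    tauto
  · ext ω
    simp only [Set.mem_inter_iff, Set.mem_compl_iff, Set.mem_ofPred_eq]
    rcases hb0 ω with h | h <;> rw [h] <;> norm_num
    tauto

lemma integral_cond_eq_cpr [IsFiniteMeasure μ] {B : Set Ω} {X : Ω → ℝ} (hX : Measurable X)
    (hb : ∀ ω, X ω = 0 ∨ X ω = 1) : ∫ ω, X ω ∂(cond μ B) = cpr μ B {ω | X ω = 1} := by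
  have hm : MeasurableSet {ω | X ω = 1} := hX (measurableSet_singleton 1)
  have hi : X = {ω | X ω = 1}.indicator 1 := by
    ext ω
    by_cases h : X ω = 1
    · simp [h]
    · simp [(hb ω).resolve_right h]
  conv_lhs => rw [hi]
  rw [integral_indicator_one hm]
  rfl

lemma integrable_of_binary [IsFiniteMeasure μ] {X : Ω → ℝ} (hX : Measurable X)
    (hb : ∀ ω, X ω = 0 ∨ X ω = 1) : Integrable X μ :=
  Integrable.of_bound hX.aestronglyMeasurable 1 (ae_of_all _ fun ω => by
    rcases hb ω with h | h <;> simp [h])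

end ConditionalProbability

set_option maxHeartbeats 1000000 in
theorem stmt17 {Ω : Type*} [MeasurableSpace Ω]
    (μ : MeasureTheory.Measure Ω) [IsProbabilityMeasure μ]
    (Z D Y D' D1 D0 Y1 Y0 : Ω → ℝ)
    (h_meas_Z : Measurable Z)
    (h_meas_D : Measurable D)
    (h_meas_Y : Measurable Y)
    (h_meas_Dp : Measurable D')
    (h_meas_D1 : Measurable D1)
    (h_meas_D0 : Measurable D0)
    (h_meas_Y1 : Measurable Y1)
    (h_meas_Y0 : Measurable Y0)
    (h_bin_Z : ∀ ω, Z ω = 0 ∨ Z ω = 1)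
    (h_bin_Dp : ∀ ω, D' ω = 0 ∨ D' ω = 1)
    (h_bin_D1 : ∀ ω, D1 ω = 0 ∨ D1 ω = 1)
    (h_bin_D0 : ∀ ω, D0 ω = 0 ∨ D0 ω = 1)
    (h_bin_Y1 : ∀ ω, Y1 ω = 0 ∨ Y1 ω = 1)
    (h_bin_Y0 : ∀ ω, Y0 ω = 0 ∨ Y0 ω = 1)
    (h_consD : ∀ ω, D ω = Z ω * D1 ω + (1 - Z ω) * D0 ω)
    (h_consY : ∀ ω, Y ω = Z ω * Y1 ω + (1 - Z ω) * Y0 ω)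
    (h_indep : IndepFun Z (fun ω => (Y1 ω, Y0 ω, D1 ω, D0 ω)) μ)
    (h_mono : ∀ᵐ ω ∂μ, D0 ω ≤ D1 ω)
    (h_exclA : cpr μ {ω | D1 ω = 1 ∧ D0 ω = 1} {ω | Y1 ω = 1}
        = cpr μ {ω | D1 ω = 1 ∧ D0 ω = 1} {ω | Y0 ω = 1})
    (h_exclN : cpr μ {ω | D1 ω = 0 ∧ D0 ω = 0} {ω | Y1 ω = 1}
        = cpr μ {ω | D1 ω = 0 ∧ D0 ω = 0} {ω | Y0 ω = 1})
    (h_posDZ : ∀ d ∈ bin01, ∀ z ∈ bin01,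
      μ ({ω | D ω = d} ∩ {ω | Z ω = z}) ≠ 0)
    (h_Uc : 0 < pr μ {ω | D1 ω = 1 ∧ D0 ω = 0})
    (SND1 SND0 SPD1 SPD0 : ℝ)
    (h_SND1 : SND1 = cpr μ ({ω | D ω = 1} ∩ {ω | Z ω = 1}) {ω | D' ω = 1})
    (h_SND0 : SND0 = cpr μ ({ω | D ω = 1} ∩ {ω | Z ω = 0}) {ω | D' ω = 1})
    (h_SPD1 : SPD1 = cpr μ ({ω | D ω = 0} ∩ {ω | Z ω = 1}) {ω | D' ω = 0})
    (h_SPD0 : SPD0 = cpr μ ({ω | D ω = 0} ∩ {ω | Z ω = 0}) {ω | D' ω = 0})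
    (h_r1 : SND1 + SPD1 - 1 ≠ 0) (h_r0 : SND0 + SPD0 - 1 ≠ 0)
    (h_delta : ((cpr μ {ω | Z ω = 1} {ω | D' ω = 1} - (1 - SPD1)) / (SND1 + SPD1 - 1)
          - (cpr μ {ω | Z ω = 0} {ω | D' ω = 1} - (1 - SPD0)) / (SND0 + SPD0 - 1)) ≠ 0) :
    ∫ ω, (Y1 ω - Y0 ω) ∂(ProbabilityTheory.cond μ {ω | D1 ω = 1 ∧ D0 ω = 0})
      = (cpr μ {ω | Z ω = 1} {ω | Y ω = 1} - cpr μ {ω | Z ω = 0} {ω | Y ω = 1})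
        / ((cpr μ {ω | Z ω = 1} {ω | D' ω = 1} - (1 - SPD1)) / (SND1 + SPD1 - 1)
          - (cpr μ {ω | Z ω = 0} {ω | D' ω = 1} - (1 - SPD0)) / (SND0 + SPD0 - 1)) := by
  have hmz : ∀ z : ℝ, MeasurableSet {ω | Z ω = z} := fun z => h_meas_Z (measurableSet_singleton z)
  have hz : ∀ z ∈ bin01, μ {ω | Z ω = z} ≠ 0 := fun z hz h =>
    h_posDZ 0 (by simp [bin01]) z hz (measure_mono_null Set.inter_subset_right h)
  have hz1 : μ {ω | Z ω = 1} ≠ 0 := hz 1 (by simp [bin01])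
  have hz0 : μ {ω | Z ω = 0} ≠ 0 := hz 0 (by simp [bin01])
  have hbD : ∀ ω, D ω = 0 ∨ D ω = 1 := by
    intro ω
    rcases h_bin_Z ω with h | h <;> simp [h_consD, h, h_bin_D1, h_bin_D0]
  have compl_eq : ∀ X : Ω → ℝ, (∀ ω, X ω = 0 ∨ X ω = 1) → {ω | X ω = 0} = {ω | X ω = 1}ᶜ := by
    intro X hX
    ext ω
    simp only [Set.mem_compl_iff, Set.mem_ofPred_eq]
    rcases hX ω with h | h <;> simp [h]
  have hDc := compl_eq D hbD
  have hTc := compl_eq D' h_bin_Dp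
  have hmD : MeasurableSet {ω | D ω = 1} := h_meas_D (measurableSet_singleton 1)
  have hmT : MeasurableSet {ω | D' ω = 1} := h_meas_Dp (measurableSet_singleton 1)
  have hIY1 : IndepFun Z Y1 μ := h_indep.comp measurable_id measurable_fst
  have hIY0 : IndepFun Z Y0 μ := h_indep.comp measurable_id measurable_snd.fst
  have hID1 : IndepFun Z D1 μ := h_indep.comp measurable_id measurable_snd.snd.fst
  have hID0 : IndepFun Z D0 μ := h_indep.comp measurable_id measurable_snd.snd.snd
  rw [hDc, hTc] at h_SPD1 h_SPD0
  subst h_SND1 h_SND0 h_SPD1 h_SPD0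
  rw [cpr_sub_one_sub_specificity_div μ (hmz 1) hmD hmT
      (h_posDZ 1 (by simp [bin01]) 1 (by simp [bin01])) h_r1,
    cpr_sub_one_sub_specificity_div μ (hmz 0) hmD hmT
      (h_posDZ 1 (by simp [bin01]) 0 (by simp [bin01])) h_r0,
    cpr_eq_pr_of_indepFun μ (V := D) h_meas_Z hID1 hz1 (fun ω h => by simp [h_consD, h]),
    cpr_eq_pr_of_indepFun μ (V := D) h_meas_Z hID0 hz0 (fun ω h => by simp [h_consD, h]),
    cpr_eq_pr_of_indepFun μ (V := Y) h_meas_Z hIY1 hz1 (fun ω h => by simp [h_consY, h]),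
    cpr_eq_pr_of_indepFun μ (V := Y) h_meas_Z hIY0 hz0 (fun ω h => by simp [h_consY, h])]
  have hm1 : ∀ d : ℝ, MeasurableSet {ω | D1 ω = d} :=
    fun d => h_meas_D1 (measurableSet_singleton d)
  have hm0 : ∀ d : ℝ, MeasurableSet {ω | D0 ω = d} :=
    fun d => h_meas_D0 (measurableSet_singleton d)
  have hmU : ∀ d e : ℝ, MeasurableSet {ω | D1 ω = d ∧ D0 ω = e} := fun d e => (hm1 d).inter (hm0 e)
  have strata := pr_eq_sum_strata μ h_meas_D1 h_meas_D0 h_bin_D1 h_bin_D0 h_mono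
  have hΔ : pr μ {ω | D1 ω = 1} - pr μ {ω | D0 ω = 1} = pr μ {ω | D1 ω = 1 ∧ D0 ω = 0} := by
    have inter_left : ∀ s t : Set Ω, s ⊆ t → pr μ (s ∩ t) = pr μ s :=
      fun s t h => by rw [Set.inter_eq_left.2 h]
    have inter_empty : ∀ s t : Set Ω, (∀ ω ∈ s, ω ∉ t) → pr μ (s ∩ t) = 0 := fun s t h => by
      rw [(Set.disjoint_left.2 h).inter_eq]
      simp [pr]
    rw [strata {ω | D1 ω = 1}, strata {ω | D0 ω = 1},
      inter_left {ω | D1 ω = 1 ∧ D0 ω = 0} {ω | D1 ω = 1} fun ω h => h.1,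
      inter_left {ω | D1 ω = 1 ∧ D0 ω = 1} {ω | D1 ω = 1} fun ω h => h.1,
      inter_left {ω | D1 ω = 1 ∧ D0 ω = 1} {ω | D0 ω = 1} fun ω h => h.2,
      inter_empty {ω | D1 ω = 0 ∧ D0 ω = 0} {ω | D1 ω = 1} fun ω h => by simp [h.1],
      inter_empty {ω | D1 ω = 1 ∧ D0 ω = 0} {ω | D0 ω = 1} fun ω h => by simp [h.2],
      inter_empty {ω | D1 ω = 0 ∧ D0 ω = 0} {ω | D0 ω = 1} fun ω h => by simp [h.2]]
    ring
  rw [hΔ, integral_sub (integrable_of_binary _ h_meas_Y1 h_bin_Y1)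
      (integrable_of_binary _ h_meas_Y0 h_bin_Y0),
    integral_cond_eq_cpr μ h_meas_Y1 h_bin_Y1, integral_cond_eq_cpr μ h_meas_Y0 h_bin_Y0,
    eq_div_iff h_Uc.ne', strata {ω | Y1 ω = 1}, strata {ω | Y0 ω = 1}]
  simp only [← pr_mul_cpr μ (hmU _ _)]
  rw [h_exclA, h_exclN]
  ring
end

section
/- Let Z be a binary (0/1) random variable and D a random variable taking values in {0,1,...,J} with potential values D_1, D_0 taking values in {0,1,...,J} and D = Z·D_1 + (1−Z)·D_0, and let Y be an integrable real-valued outcome. Suppose Z is independent of (D_1, D_0), D_1 ≥ D_0 almost surely, 0 < P(Z=1) < 1, and for a fixed k ∈ {1,...,J} set D' = 1{D ≥ k}. If Σ_{j=1}^{J} P(D_1 ≥ j > D_0) > 0 and P(D_1 ≥ k > D_0) > 0, then E(D|Z=1) − E(D|Z=0) = Σ_{j=1}^{J} P(D_1 ≥ j > D_0), E(D'|Z=1) − E(D'|Z=0) = P(D_1 ≥ k > D_0), and consequently τ_2sls = τ'_2sls × w_k, where τ_2sls = [E(Y|Z=1) − E(Y|Z=0)] / [E(D|Z=1) − E(D|Z=0)],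 τ'_2sls = [E(Y|Z=1) − E(Y|Z=0)] / [E(D'|Z=1) − E(D'|Z=0)], and w_k = P(D_1 ≥ k > D_0) / Σ_{j=1}^{J} P(D_1 ≥ j > D_0). -/
open MeasureTheory ProbabilityTheory

/-- Conditioning on an event of positive probability generated by `Z` does not change the law of a
random element independent of `Z`. -/
theorem map_cond_preimage_of_indepFun {Ω α β : Type*} [MeasurableSpace Ω] [MeasurableSpace α]
    [MeasurableSpace β] {μ : Measure Ω} [IsFiniteMeasure μ] {Z : Ω → α} {X : Ω → β}
    (hZ : Measurable Z) (hX : Measurable X) (h : IndepFun Z X μ) {s : Set α}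
    (hs : MeasurableSet s) (h_ne : μ (Z ⁻¹' s) ≠ 0) :
    (ProbabilityTheory.cond μ (Z ⁻¹' s)).map X = μ.map X := by
  ext t ht
  rw [Measure.map_apply hX ht, Measure.map_apply hX ht, cond_apply (hZ hs),
    h.measure_inter_preimage_eq_mul _ _ hs ht, ← mul_assoc,
    ENNReal.inv_mul_cancel h_ne (measure_ne_top _ _), one_mul]

theorem integral_cond_preimage_of_indepFun {Ω α β : Type*} [MeasurableSpace Ω]
    [MeasurableSpace α] [MeasurableSpace β] {μ : Measure Ω} [IsFiniteMeasure μ] {Z : Ω → α}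
    {X : Ω → β} (hZ : Measurable Z) (hX : Measurable X) (h : IndepFun Z X μ) {s : Set α}
    (hs : MeasurableSet s) (h_ne : μ (Z ⁻¹' s) ≠ 0) {f : β → ℝ} (hf : Measurable f) :
    ∫ ω, f (X ω) ∂(ProbabilityTheory.cond μ (Z ⁻¹' s)) = ∫ ω, f (X ω) ∂μ := by
  rw [← integral_map hX.aemeasurable hf.aestronglyMeasurable,
    map_cond_preimage_of_indepFun hZ hX h hs h_ne,
    integral_map hX.aemeasurable hf.aestronglyMeasurable]

theorem integrable_ite_le {Ω : Type*} [MeasurableSpace Ω] {ν : Measure Ω} [IsFiniteMeasure ν]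
    {X : Ω → ℕ} (hX : Measurable X) (j : ℕ) :
    Integrable (fun ω => if j ≤ X ω then (1 : ℝ) else 0) ν :=
  Integrable.of_bound
    ((measurable_of_countable (fun n : ℕ => if j ≤ n then (1 : ℝ) else 0)).comp
      hX).aestronglyMeasurable 1 (.of_forall fun ω => by
      split_ifs <;> simp)

theorem integral_ite_le_sub_of_ae_le {Ω : Type*} [MeasurableSpace Ω] {μ : Measure Ω}
    [IsFiniteMeasure μ] {X₁ X₀ : Ω → ℕ} (h₁ : Measurable X₁) (h₀ : Measurable X₀)
    (h_le : ∀ᵐ ω ∂μ, X₀ ω ≤ X₁ ω) (j : ℕ) :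
    ∫ ω, (if j ≤ X₁ ω then (1 : ℝ) else 0) ∂μ - ∫ ω, (if j ≤ X₀ ω then (1 : ℝ) else 0) ∂μ
      = pr μ {ω | X₀ ω < j ∧ j ≤ X₁ ω} := by
  have h_meas : MeasurableSet {ω | X₀ ω < j ∧ j ≤ X₁ ω} :=
    (measurableSet_lt h₀ measurable_const).inter (measurableSet_le measurable_const h₁)
  rw [← integral_sub (integrable_ite_le h₁ j) (integrable_ite_le h₀ j), pr, ← measureReal_def,
    ← integral_indicator_one h_meas]
  refine integral_congr_ae ?_
  filter_upwards [h_le] with ω hω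
  simp only [Set.indicator_apply, Set.mem_ofPred_eq, Pi.one_apply]
  split_ifs <;> first | omega | norm_num

theorem natCast_eq_sum_ite_le {J n : ℕ} (h : n ≤ J) :
    (n : ℝ) = ∑ j ∈ Finset.Icc 1 J, if j ≤ n then (1 : ℝ) else 0 := by
  have h_filter : (Finset.Icc 1 J).filter (· ≤ n) = Finset.Icc 1 n := by
    ext j
    simp only [Finset.mem_filter, Finset.mem_Icc]
    omega
  rw [Finset.sum_boole, h_filter, Nat.card_Icc, Nat.add_sub_cancel]

set_option maxHeartbeats 1000000 in
theorem stmt18 {Ω : Type*} [MeasurableSpace Ω]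
    (μ : MeasureTheory.Measure Ω) [IsProbabilityMeasure μ]
    (J k : ℕ) (h_k1 : 1 ≤ k) (h_kJ : k ≤ J)
    (Z : Ω → ℝ) (D D1 D0 : Ω → ℕ) (Y : Ω → ℝ)
    (h_meas_Z : Measurable Z) (h_meas_D : Measurable D)
    (h_meas_D1 : Measurable D1) (h_meas_D0 : Measurable D0)
    (h_meas_Y : Measurable Y) (h_int_Y : Integrable Y μ)
    (h_bin_Z : ∀ ω, Z ω = 0 ∨ Z ω = 1)
    (h_range_D1 : ∀ ω, D1 ω ≤ J) (h_range_D0 : ∀ ω, D0 ω ≤ J)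
    (h_cons : ∀ ω, D ω = if Z ω = 1 then D1 ω else D0 ω)
    (h_indep : IndepFun Z (fun ω => (D1 ω, D0 ω)) μ)
    (h_mono : ∀ᵐ ω ∂μ, D0 ω ≤ D1 ω)
    (h_Zpos : 0 < pr μ {ω | Z ω = 1}) (h_Zlt : pr μ {ω | Z ω = 1} < 1)
    (h_sum_pos : 0 < ∑ j ∈ Finset.Icc 1 J, pr μ {ω | D0 ω < j ∧ j ≤ D1 ω})
    (h_k_pos : 0 < pr μ {ω | D0 ω < k ∧ k ≤ D1 ω}) :
    (∫ ω, (D ω : ℝ) ∂(ProbabilityTheory.cond μ {ω | Z ω = 1}) - ∫ ω, (D ω : ℝ) ∂(ProbabilityTheory.cond μ {ω | Z ω = 0}) = ∑ j ∈ Finset.Icc 1 J, pr μ {ω | D0 ω < j ∧ j ≤ D1 ω})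
    ∧ (∫ ω, (if k ≤ D ω then (1 : ℝ) else 0) ∂(ProbabilityTheory.cond μ {ω | Z ω = 1}) - ∫ ω, (if k ≤ D ω then (1 : ℝ) else 0) ∂(ProbabilityTheory.cond μ {ω | Z ω = 0}) = pr μ {ω | D0 ω < k ∧ k ≤ D1 ω})
    ∧ ((∫ ω, Y ω ∂(ProbabilityTheory.cond μ {ω | Z ω = 1}) - ∫ ω, Y ω ∂(ProbabilityTheory.cond μ {ω | Z ω = 0})) / (∫ ω, (D ω : ℝ) ∂(ProbabilityTheory.cond μ {ω | Z ω = 1}) - ∫ ω, (D ω : ℝ) ∂(ProbabilityTheory.cond μ {ω | Z ω = 0}))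
        = (∫ ω, Y ω ∂(ProbabilityTheory.cond μ {ω | Z ω = 1}) - ∫ ω, Y ω ∂(ProbabilityTheory.cond μ {ω | Z ω = 0})) / (∫ ω, (if k ≤ D ω then (1 : ℝ) else 0) ∂(ProbabilityTheory.cond μ {ω | Z ω = 1}) - ∫ ω, (if k ≤ D ω then (1 : ℝ) else 0) ∂(ProbabilityTheory.cond μ {ω | Z ω = 0}))
          * (pr μ {ω | D0 ω < k ∧ k ≤ D1 ω} / (∑ j ∈ Finset.Icc 1 J, pr μ {ω | D0 ω < j ∧ j ≤ D1 ω}))) := by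
  have h_ms (z : ℝ) : MeasurableSet {ω | Z ω = z} := h_meas_Z (measurableSet_singleton z)
  have h_compl : {ω | Z ω = 0} = {ω | Z ω = 1}ᶜ := by
    ext ω
    rcases h_bin_Z ω with h | h <;> simp [h]
  have h_ne1 : μ {ω | Z ω = 1} ≠ 0 := fun h => by simp [pr, h] at h_Zpos
  have h_ne0 : μ {ω | Z ω = 0} ≠ 0 := fun h => by
    rw [h_compl, prob_compl_eq_zero_iff (h_ms 1)] at h
    simp [pr, h] at h_Zlt
  have h_f (j : ℕ) : Measurable (fun n : ℕ => if j ≤ n then (1 : ℝ) else 0) :=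
    measurable_of_countable _
  have h_dich (j : ℕ) :
      ∫ ω, (if j ≤ D ω then (1 : ℝ) else 0) ∂(ProbabilityTheory.cond μ {ω | Z ω = 1})
        - ∫ ω, (if j ≤ D ω then (1 : ℝ) else 0) ∂(ProbabilityTheory.cond μ {ω | Z ω = 0})
        = pr μ {ω | D0 ω < j ∧ j ≤ D1 ω} := by
    rw [← integral_ite_le_sub_of_ae_le h_meas_D1 h_meas_D0 h_mono j]
    congr 1
    · refine Eq.trans (integral_congr_ae ?_) (integral_cond_preimage_of_indepFun h_meas_Z
        h_meas_D1 (h_indep.comp measurable_id measurable_fst) (measurableSet_singleton 1)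
        h_ne1 (h_f j))
      filter_upwards [ae_cond_mem (h_ms 1)] with ω hω
      rw [h_cons, if_pos hω]
    · refine Eq.trans (integral_congr_ae ?_) (integral_cond_preimage_of_indepFun h_meas_Z
        h_meas_D0 (h_indep.comp measurable_id measurable_snd) (measurableSet_singleton 0)
        h_ne0 (h_f j))
      filter_upwards [ae_cond_mem (h_ms 0)] with ω hω
      have hω' : Z ω ≠ 1 := by rw [show Z ω = 0 from hω]; exact zero_ne_one
      rw [h_cons, if_neg hω']
  have h_D_le (ω : Ω) : D ω ≤ J := by
    rw [h_cons]
    split_ifs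
    exacts [h_range_D1 ω, h_range_D0 ω]
  have h_mean : ∫ ω, (D ω : ℝ) ∂(ProbabilityTheory.cond μ {ω | Z ω = 1})
      - ∫ ω, (D ω : ℝ) ∂(ProbabilityTheory.cond μ {ω | Z ω = 0})
      = ∑ j ∈ Finset.Icc 1 J, pr μ {ω | D0 ω < j ∧ j ≤ D1 ω} := by
    simp_rw [fun ω => natCast_eq_sum_ite_le (h_D_le ω)]
    rw [integral_finsetSum _ fun j _ => integrable_ite_le h_meas_D j,
      integral_finsetSum _ fun j _ => integrable_ite_le h_meas_D j, ← Finset.sum_sub_distrib]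
    exact Finset.sum_congr rfl fun j _ => h_dich j
  refine ⟨h_mean, h_dich k, ?_⟩
  rw [h_mean, h_dich k, div_mul_div_cancel₀ h_k_pos.ne']
end
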